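/- Let n ≥ 2 and let c be a self-conjugate 2n-core, so φ_{2n}(c) = (m_0,…,m_{n−1}, −m_{n−1},…,−m_0). Set c′ := φ_{2n+1}^{-1}(0, m_0,…,m_{n−1}, −m_{n−1},…,−m_0). Then c′ is a doubled distinct (2n+1)-core, and there exists a unique distinct partition λ̄ ∈ 𝒞_{2n+1}^{d,r} with c′ = λ̄λ̄; moreover |λ̄| = (1/2)(|c| + a_0(c)), where a_0(c) is the number of boxes of c whose residue modulo 2n equals 0. -/

import Mathlib

open scoped Classical

/-- `p k` is the `(k+1)`-st part `λ_{k+1}` of the partition `λ` :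
partitions are encoded by their (eventually zero, antitone) sequence of parts. -/
def IsPartition (p : ℕ → ℕ) : Prop :=
  Antitone p ∧ ∃ N, ∀ i, N ≤ i → p i = 0

/-- The number of (nonzero) parts of a partition. -/
noncomputable def plen (p : ℕ → ℕ) : ℕ := Nat.card {i : ℕ // p i ≠ 0}

/-- The number of boxes `|λ|` of a partition. -/
noncomputable def psize (p : ℕ → ℕ) : ℕ := ∑ i ∈ Finset.range (plen p), p i

/-- The conjugate partition : `pconj p j = λ^tr_{j+1}`. -/
noncomputable def pconj (p : ℕ → ℕ) (j : ℕ) : ℕ := Nat.card {i : ℕ // j + 1 ≤ p i}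

/-- The size of the Durfee square of a partition. -/
noncomputable def durfee (p : ℕ → ℕ) : ℕ := Nat.card {i : ℕ // i + 1 ≤ p i}

/-- The cells (boxes) of the Young diagram, `0`-indexed : `(i, j)` is the box in
row `i+1` and column `j+1`. -/
noncomputable def cells (p : ℕ → ℕ) : Finset (ℕ × ℕ) :=
  (Finset.range (plen p) ×ˢ Finset.range (p 0)).filter fun s => s.2 < p s.1

/-- The hook length of the (0-indexed) box `(i, j)` :
`h = λ_{i+1} - (j+1) + λ^tr_{j+1} - (i+1) + 1`. -/
noncomputable def hookLen (p : ℕ → ℕ) (i j : ℕ) : ℕ :=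
  (p i - j) + (pconj p j - i) - 1

/-- The multiset of hook lengths `ℋ(λ)`. -/
noncomputable def hooks (p : ℕ → ℕ) : Multiset ℕ :=
  (cells p).val.map fun s => hookLen p s.1 s.2

/-- The multiset of hook lengths of the boxes strictly above the main diagonal. -/
noncomputable def hooksAbove (p : ℕ → ℕ) : Multiset ℕ :=
  ((cells p).filter fun s => s.1 < s.2).val.map fun s => hookLen p s.1 s.2

/-- The multiset of hook lengths of the boxes strictly below the main diagonal. -/
noncomputable def hooksBelow (p : ℕ → ℕ) : Multiset ℕ :=
  ((cells p).filter fun s => s.2 < s.1).val.map fun s => hookLen p s.1 s.2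

/-- `p` is an `n`-core : no hook length is equal to `n`. -/
def IsCore (n : ℕ) (p : ℕ → ℕ) : Prop := n ∉ hooks p

/-- Self-conjugate partitions. -/
def SelfConj (p : ℕ → ℕ) : Prop := p = pconj p

/-- Distinct partitions (strictly decreasing nonzero parts). -/
def IsDistinct (p : ℕ → ℕ) : Prop := ∀ i, p (i + 1) ≠ 0 → p (i + 1) < p i

/-- Doubled distinct partitions : `λ_i = λ^tr_i + 1` for `i` at most
the size of the Durfee square. -/
def IsDD (p : ℕ → ℕ) : Prop := ∀ i < durfee p, p i = pconj p i + 1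

/-- Conjugates of doubled distinct partitions. -/
def IsDDtr (p : ℕ → ℕ) : Prop := ∃ q, IsPartition q ∧ IsDD q ∧ p = pconj q

/-- The doubled distinct partition `λ̄λ̄` of a distinct partition `λ̄` :
add `λ̄_i` boxes to the `i`-th column of the shifted Young diagram of `λ̄`. -/
noncomputable def double (b : ℕ → ℕ) : ℕ → ℕ := fun i =>
  if i < plen b then b i + (i + 1)
  else Nat.card {j : ℕ // j < plen b ∧ i + 1 ≤ b j + j}

/-- The self-conjugate partition associated with a distinct partition `λ̄` :
add `λ̄_i - 1` boxes to the `i`-th column of the shifted Young diagram of `λ̄`. -/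
noncomputable def scOf (b : ℕ → ℕ) : ℕ → ℕ := fun i =>
  if i < plen b then b i + i
  else Nat.card {j : ℕ // j < plen b ∧ i + 1 ≤ b j + j}

/-- The binary word `ψ(λ) = (c_k)_{k ∈ ℤ}` of a partition :
`c_k = 0` iff `k ∈ {λ_i - i : i ≥ 1}` and `c_k = 1` otherwise
(i.e. iff `k ∈ {j - λ^tr_j - 1 : j ≥ 1}`). -/
noncomputable def word (p : ℕ → ℕ) (k : ℤ) : ℕ :=
  if ∃ m : ℕ, k = (p m : ℤ) - ((m : ℤ) + 1) then 0 else 1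

/-- The `g`-charge of a `g`-core : `m_i = min {k ∈ ℤ : c_{kg+i} = 1}`. -/
noncomputable def ncharge (g : ℕ) (p : ℕ → ℕ) (i : ℕ) : ℤ :=
  sInf {k : ℤ | word p (k * (g : ℤ) + (i : ℤ)) = 1}

/-- The subword of residue `k` modulo `g` of the word of `p`. -/
noncomputable def subword (g k : ℕ) (p : ℕ → ℕ) (i : ℤ) : ℕ :=
  word p ((g : ℤ) * i + (k : ℤ))

/-- The shift turning the subword of residue `k` into a balanced partition word. -/
noncomputable def qcharge (g : ℕ) (p : ℕ → ℕ) (k : ℕ) : ℤ :=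
  (Nat.card {i : ℕ // subword g k p (i : ℤ) = 0} : ℤ) -
    (Nat.card {i : ℕ // subword g k p (-((i : ℤ) + 1)) = 1} : ℤ)

/-- `ν` is the `k`-th component of the `g`-quotient of `p` : its word is the
subword of residue `k` of the word of `p`, reindexed so as to be balanced. -/
def IsQuotientAt (g : ℕ) (p : ℕ → ℕ) (k : ℕ) (ν : ℕ → ℕ) : Prop :=
  ∀ i : ℤ, word ν i = subword g k p (i + qcharge g p k)

/-- `ω` is the `g`-core of `p` : every subword of its word is sorted
(all `0`'s, then all `1`'s), with transition index the charge of `p`. -/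
def IsCoreOf (g : ℕ) (p ω : ℕ → ℕ) : Prop :=
  ∀ k < g, ∀ i : ℤ, (subword g k ω i = 1 ↔ qcharge g p k ≤ i)

/-- `(ω, ν)` is the Littlewood decomposition of `p` for the modulus `g`. -/
def IsLittlewood (g : ℕ) (p ω : ℕ → ℕ) (ν : ℕ → ℕ → ℕ) : Prop :=
  IsCoreOf g p ω ∧ ∀ k < g, IsQuotientAt g p k (ν k)

/-- The number `a_r` of boxes of residue `r` modulo `g`
(the residue of the box `(i, j)` -- `0`-indexed -- being `(j - i) mod g`). -/
noncomputable def resCount (g : ℕ) (p : ℕ → ℕ) (r : ℕ) : ℕ :=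
  ((cells p).filter fun s => ((s.2 : ℤ) - (s.1 : ℤ)) % (g : ℤ) = (r : ℤ)).card

/-- The rectangular partition with `r` rows of length `c`. -/
def rect (r c : ℕ) : ℕ → ℕ := fun i => if i < r then c else 0

/-- The statistic `m = max({1} ∪ {(g + λ̄_i)/g : λ̄_i ≡ 0 (mod g)})`. -/
noncomputable def mStat (g : ℕ) (b : ℕ → ℕ) : ℕ :=
  sSup ({1} ∪ {k : ℕ | ∃ i < plen b, g ∣ b i ∧ k = (g + b i) / g})

/-- The statistic `m' = max({0} ∪ {λ̄_i/g : λ̄_i ≡ g/2 (mod g)})`. -/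
noncomputable def mStat' (g : ℕ) (b : ℕ → ℕ) : ℕ :=
  sSup ({0} ∪ {k : ℕ | ∃ i < plen b, 2 * (b i % g) = g ∧ k = b i / g})

/-- The vector `(0, m_0, …, m_{n-1}, -m_{n-1}, …, -m_0)` of length `2n + 1`. -/
noncomputable def extVecA (n : ℕ) (m : ℕ → ℤ) : ℕ → ℤ := fun i =>
  if i = 0 then 0
  else if i ≤ n then m (i - 1)
  else if i ≤ 2 * n then - m (2 * n - i)
  else 0

/-- The set `{λ_i - i : i ≥ 1}` of positions of the zeros of the word of a partition. -/
def betaSet (p : ℕ → ℕ) : Set ℤ := Set.range fun m : ℕ => (p m : ℤ) - ((m : ℤ) + 1)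

/-- The order isomorphism from `ℤ` onto the non-multiples of `2n + 1` inserting a multiple of
`2n + 1` before each block of `2n` consecutive integers. -/
def spread (n : ℕ) (x : ℤ) : ℤ := x + x / (2 * n : ℤ) + 1

theorem card_subtype_lt (k : ℕ) : Nat.card {i : ℕ // i < k} = k := by
  rw [Nat.card_congr (Fin.equivSubtype (n := k)).symm, Nat.card_fin]

theorem lt_card_iff {P : ℕ → Prop} (hP : ∀ i j, i ≤ j → P j → P i)
    (hb : ∃ N, ∀ i, N ≤ i → ¬ P i) (i : ℕ) : i < Nat.card {i : ℕ // P i} ↔ P i := by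
  have hk : ∀ i, P i ↔ i < Nat.find hb := by
    intro i
    constructor
    · intro h
      by_contra hlt
      exact Nat.find_spec hb i (not_lt.mp hlt) h
    · intro h
      have hmin := Nat.find_min hb h
      push Not at hmin
      obtain ⟨j, hij, hj⟩ := hmin
      exact hP i j hij hj
  rw [Nat.card_congr (Equiv.subtypeEquivRight hk), card_subtype_lt, hk]

theorem IsPartition.lt_plen_iff {p : ℕ → ℕ} (hp : IsPartition p)
    (i : ℕ) : i < plen p ↔ p i ≠ 0 := by
  obtain ⟨ha, N, hN⟩ := hp
  refine lt_card_iff (P := fun i => p i ≠ 0) ?_ ⟨N, fun i hi => by simp [hN i hi]⟩ i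
  intro i j hij hj
  have := ha hij
  omega

theorem IsPartition.lt_pconj_iff {p : ℕ → ℕ} (hp : IsPartition p)
    (i j : ℕ) : i < pconj p j ↔ j < p i := by
  obtain ⟨ha, N, hN⟩ := hp
  refine lt_card_iff (P := fun i => j + 1 ≤ p i) ?_ ⟨N, fun i hi => by simp [hN i hi]⟩ i
  intro i j hij hj
  have := ha hij
  omega

theorem IsPartition.lt_durfee_iff {p : ℕ → ℕ} (hp : IsPartition p)
    (i : ℕ) : i < durfee p ↔ i < p i := by
  obtain ⟨ha, N, hN⟩ := hp
  refine lt_card_iff (P := fun i => i + 1 ≤ p i) ?_ ⟨N, fun i hi => by simp [hN i hi]⟩ i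
  intro i j hij hj
  have := ha hij
  omega

theorem IsPartition.mem_cells_iff {p : ℕ → ℕ} (hp : IsPartition p)
    (s : ℕ × ℕ) : s ∈ cells p ↔ s.2 < p s.1 := by
  have h0 := hp.1 (Nat.zero_le s.1)
  simp only [cells, Finset.mem_filter, Finset.mem_product, Finset.mem_range, hp.lt_plen_iff]
  omega

theorem IsPartition.strictAnti_beta {p : ℕ → ℕ} (hp : IsPartition p) :
    StrictAnti fun m : ℕ => (p m : ℤ) - ((m : ℤ) + 1) := by
  intro i j hij
  have := hp.1 hij.le
  simp only
  omega

theorem IsPartition.strictAnti_beta_pconj {p : ℕ → ℕ} (hp : IsPartition p) :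
    StrictAnti fun m : ℕ => (pconj p m : ℤ) - (m : ℤ) := by
  refine strictAnti_nat_of_succ_lt fun j => ?_
  have h : pconj p (j + 1) ≤ pconj p j := by
    by_contra! hlt
    have := (hp.lt_pconj_iff _ _).mp hlt
    have := (hp.lt_pconj_iff (pconj p j) j).mpr (by omega)
    omega
  push_cast
  omega

/-- A gap of the beta-set lies at `j - λ^tr_j`, columns being counted from `0`. -/
theorem IsPartition.exists_of_notMem_betaSet {p : ℕ → ℕ} (hp : IsPartition p)
    {k : ℤ} (hk : k ∉ betaSet p) : ∃ j : ℕ, k = (j : ℤ) - pconj p j := by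
  have hex : ∃ m : ℕ, (p m : ℤ) - ((m : ℤ) + 1) < k := by
    obtain ⟨-, N, hN⟩ := hp
    refine ⟨max N (-k).toNat, ?_⟩
    rw [hN _ (le_max_left _ _)]
    have := Int.self_le_toNat (-k)
    have := le_max_right N (-k).toNat
    push_cast
    omega
  have hlow := Nat.find_spec hex
  have hmin := fun m => @Nat.find_min _ _ hex m
  set a := Nat.find hex
  refine ⟨(k + a).toNat, ?_⟩
  have hpc : pconj p (k + a).toNat = a := by
    refine eq_of_forall_lt_iff fun m => ?_
    rw [hp.lt_pconj_iff]
    constructor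
    · intro hm
      by_contra! ham
      have := hp.1 ham
      omega
    · intro hm
      have h1 := hmin (a - 1) (by omega)
      have h2 : k ≠ (p (a - 1) : ℤ) - (((a - 1 : ℕ) : ℤ) + 1) := fun h => hk ⟨_, h.symm⟩
      have := hp.1 (show m ≤ a - 1 by omega)
      omega
  rw [hpc]
  omega

theorem IsPartition.sub_pconj_notMem_betaSet {p : ℕ → ℕ} (hp : IsPartition p) (j : ℕ) :
    (j : ℤ) - pconj p j ∉ betaSet p := by
  rintro ⟨m, hm⟩
  have := hp.lt_pconj_iff m j
  simp only at hm
  omega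

theorem IsPartition.notMem_betaSet_iff {p : ℕ → ℕ} (hp : IsPartition p) {k : ℤ} :
    k ∉ betaSet p ↔ ∃ j : ℕ, k = (j : ℤ) - pconj p j :=
  ⟨hp.exists_of_notMem_betaSet, fun ⟨j, hj⟩ => hj ▸ hp.sub_pconj_notMem_betaSet j⟩

theorem IsPartition.betaSet_sub_mem {p : ℕ → ℕ} (hp : IsPartition p) {g : ℕ} (hg : 0 < g)
    (hcore : IsCore g p) {x : ℤ} (hx : x ∈ betaSet p) :
    x - g ∈ betaSet p := by
  by_contra hy
  obtain ⟨j, hj⟩ := hp.exists_of_notMem_betaSet hy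
  obtain ⟨i, rfl⟩ := hx
  have hij := hp.lt_pconj_iff i j
  simp only at hj
  refine hcore (Multiset.mem_map.mpr ⟨(i, j), ?_, ?_⟩)
  · rw [Finset.mem_val, hp.mem_cells_iff]
    simp only
    omega
  · simp only [hookLen]
    omega

theorem IsPartition.lt_of_mem_betaSet {p : ℕ → ℕ} (hp : IsPartition p)
    {x : ℤ} (hx : x ∈ betaSet p) : x < p 0 := by
  obtain ⟨m, rfl⟩ := hx
  have := hp.1 (Nat.zero_le m)
  simp only
  omega

theorem IsPartition.mem_betaSet_of_le {p : ℕ → ℕ} (hp : IsPartition p) :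
    ∃ N : ℕ, ∀ x : ℤ, x ≤ -N → x ∈ betaSet p := by
  obtain ⟨-, N, hN⟩ := hp
  refine ⟨N + 1, fun x hx => ⟨(-x - 1).toNat, ?_⟩⟩
  simp only
  rw [hN _ (by omega)]
  push_cast at hx ⊢
  omega

theorem IsPartition.mem_betaSet_iff_lt_ncharge {p : ℕ → ℕ} (hp : IsPartition p)
    {g : ℕ} (hg : 0 < g) (hcore : IsCore g p)
    (k : ℤ) (i : ℕ) : k * g + i ∈ betaSet p ↔ k < ncharge g p i := by
  have hg' : (1 : ℤ) ≤ g := by exact_mod_cast hg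
  have hS : {k : ℤ | word p (k * (g : ℤ) + (i : ℤ)) = 1} = {k : ℤ | k * g + i ∉ betaSet p} := by
    ext k
    simp only [word, betaSet, Set.mem_range, Set.mem_ofPred_eq, eq_comm (b := k * (g : ℤ) + i)]
    split_ifs with h <;> simp [h]
  have hdown : ∀ (d : ℕ) (k : ℤ), k * g + i ∈ betaSet p → (k - d) * g + i ∈ betaSet p := by
    intro d
    induction d with
    | zero => simp
    | succ d ih =>
      intro k hk
      convert hp.betaSet_sub_mem hg hcore (ih k hk) using 1
      push_cast
      ring
  unfold ncharge
  rw [hS]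
  have hne : {k : ℤ | k * g + i ∉ betaSet p}.Nonempty := by
    refine ⟨p 0, fun h => ?_⟩
    have := hp.lt_of_mem_betaSet h
    nlinarith
  have hbdd : BddBelow {k : ℤ | k * g + i ∉ betaSet p} := by
    obtain ⟨N, hN⟩ := hp.mem_betaSet_of_le
    refine ⟨-N - i, fun k hk => ?_⟩
    by_contra! hlt
    exact hk (hN _ (by nlinarith))
  constructor
  · intro hk
    by_contra! hle
    have hmem := Int.csInf_mem hne hbdd
    refine hmem ?_
    convert hdown (k - sInf {k : ℤ | k * g + i ∉ betaSet p}).toNat k hk using 2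
    rw [Int.toNat_of_nonneg (by omega)]
    ring
  · intro hk
    by_contra hnot
    exact absurd (csInf_le hbdd hnot) (not_le.mpr hk)

theorem IsPartition.mem_betaSet_iff_of_selfConj {p : ℕ → ℕ} (hp : IsPartition p)
    (hsc : SelfConj p) (x : ℤ) :
    x ∈ betaSet p ↔ -1 - x ∉ betaSet p := by
  rw [hp.notMem_betaSet_iff, ← hsc]
  constructor
  · rintro ⟨m, rfl⟩
    exact ⟨m, by simp only; ring⟩
  · rintro ⟨j, hj⟩
    exact ⟨j, by simp only; linarith⟩

theorem IsPartition.ncharge_of_selfConj {p : ℕ → ℕ} (hp : IsPartition p) {n : ℕ} (hn : 0 < n)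
    (hcore : IsCore (2 * n) p) (hsc : SelfConj p) {i : ℕ} (hi : i < 2 * n) :
    ncharge (2 * n) p (2 * n - 1 - i) = - ncharge (2 * n) p i := by
  refine eq_of_forall_lt_iff fun k => ?_
  rw [← hp.mem_betaSet_iff_lt_ncharge (by omega) hcore, hp.mem_betaSet_iff_of_selfConj hsc]
  have : -1 - (k * ((2 * n : ℕ) : ℤ) + ((2 * n - 1 - i : ℕ) : ℤ))
      = (-k - 1) * ((2 * n : ℕ) : ℤ) + i := by
    rw [Nat.sub_sub, Nat.cast_sub (by omega)]
    push_cast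
    ring
  rw [this, hp.mem_betaSet_iff_lt_ncharge (by omega) hcore]
  omega

theorem IsPartition.psize_eq_card_cells {p : ℕ → ℕ} (hp : IsPartition p) :
    psize p = (cells p).card := by
  rw [psize, Finset.card_eq_sum_ones,
    Finset.sum_finset_product (cells p) (Finset.range (plen p)) (fun i => Finset.range (p i))]
  · simp
  · intro s
    rw [hp.mem_cells_iff, Finset.mem_range, Finset.mem_range, hp.lt_plen_iff]
    omega

/-- Strictly decreasing sequences with the same positive values have the same positive terms. -/
theorem StrictAnti.eq_of_pos_of_range {u v : ℕ → ℤ} (hu : StrictAnti u) (hv : StrictAnti v)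
    (h : ∀ y, 0 < y → (y ∈ Set.range u ↔ y ∈ Set.range v)) (i : ℕ) (hi : 0 < u i) :
    u i = v i := by
  induction i using Nat.strong_induction_on with
  | _ i ih =>
    obtain ⟨j, hj⟩ := (h _ hi).mp ⟨i, rfl⟩
    rcases lt_trichotomy j i with hji | rfl | hij
    · have := hu hji
      have := ih j hji (by omega)
      omega
    · exact hj.symm
    · have hlt := hv hij
      obtain ⟨k, hk⟩ := (h (v i) (by omega)).mpr ⟨i, rfl⟩
      have hki : k < i := hu.lt_iff_gt.mp (by omega)
      have := ih k hki (by omega)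
      have := hv hki
      omega

theorem spread_block {n : ℕ} (hn : 0 < n) (k : ℤ) {i : ℕ} (hi : i < 2 * n) :
    spread n (k * ((2 * n : ℕ) : ℤ) + i) = k * ((2 * n + 1 : ℕ) : ℤ) + ((i + 1 : ℕ) : ℤ) := by
  have : (k * ((2 * n : ℕ) : ℤ) + i) / (2 * n : ℤ) = k := by
    have h2 : (i : ℤ) / (2 * n : ℤ) = 0 := Int.ediv_eq_zero_of_lt (by omega) (by omega)
    push_cast
    rw [add_comm, Int.add_mul_ediv_right _ _ (by omega), h2, zero_add]
  rw [spread, this]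
  push_cast
  ring

theorem exists_block {n : ℕ} (hn : 0 < n) (x : ℤ) :
    ∃ (k : ℤ) (i : ℕ), i < 2 * n ∧ x = k * ((2 * n : ℕ) : ℤ) + i := by
  have h0 := Int.emod_nonneg x (show ((2 * n : ℕ) : ℤ) ≠ 0 by omega)
  have h1 := Int.emod_lt_of_pos x (show (0 : ℤ) < ((2 * n : ℕ) : ℤ) by omega)
  refine ⟨x / ((2 * n : ℕ) : ℤ), (x % ((2 * n : ℕ) : ℤ)).toNat, by omega, ?_⟩
  rw [Int.toNat_of_nonneg h0, mul_comm, Int.mul_ediv_add_emod]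

theorem eq_mul_or_eq_spread {n : ℕ} (hn : 0 < n) (y : ℤ) :
    (∃ k : ℤ, y = k * ((2 * n + 1 : ℕ) : ℤ)) ∨ ∃ x : ℤ, y = spread n x := by
  have h0 := Int.emod_nonneg y (show ((2 * n + 1 : ℕ) : ℤ) ≠ 0 by omega)
  have h1 := Int.emod_lt_of_pos y (show (0 : ℤ) < ((2 * n + 1 : ℕ) : ℤ) by omega)
  have h2 := Int.mul_ediv_add_emod y ((2 * n + 1 : ℕ) : ℤ)
  set k := y / ((2 * n + 1 : ℕ) : ℤ)
  rcases h0.eq_or_lt with h | h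
  · exact Or.inl ⟨k, by rw [mul_comm]; omega⟩
  · refine Or.inr ⟨k * ((2 * n : ℕ) : ℤ) + ((y % ((2 * n + 1 : ℕ) : ℤ) - 1).toNat : ℕ), ?_⟩
    rw [spread_block hn k (by omega), mul_comm k]
    omega

theorem neg_spread {n : ℕ} (hn : 0 < n) (x : ℤ) : - spread n x = spread n (-1 - x) := by
  obtain ⟨k, i, hi, rfl⟩ := exists_block hn x
  have : -1 - (k * ((2 * n : ℕ) : ℤ) + i)
      = (-k - 1) * ((2 * n : ℕ) : ℤ) + ((2 * n - 1 - i : ℕ) : ℤ) := by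
    rw [Nat.sub_sub, Nat.cast_sub (by omega)]
    push_cast
    ring
  rw [this, spread_block hn _ hi, spread_block hn _ (by omega)]
  rw [show 2 * n - 1 - i + 1 = 2 * n - i by omega, Nat.cast_sub (by omega)]
  push_cast
  ring

theorem strictMono_spread {n : ℕ} (hn : 0 < n) : StrictMono (spread n) := by
  intro x y hxy
  have := Int.ediv_le_ediv (show (0 : ℤ) < 2 * n by omega) hxy.le
  simp only [spread]
  omega

theorem spread_pos_iff {n : ℕ} (hn : 0 < n) (x : ℤ) : 0 < spread n x ↔ 0 ≤ x := by
  have h : spread n 0 = 1 := by simp [spread]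
  rw [← (strictMono_spread hn).le_iff_le, h]
  omega

/-- The relation between the beta-sets of a self-conjugate `2n`-core with charge
`(m_0, …, m_{2n-1})` and of the `(2n+1)`-core with charge `(0, m_0, …, m_{2n-1})`. -/
structure IsSpread (n : ℕ) (B B' : Set ℤ) : Prop where
  symm_iff : ∀ x, x ∈ B ↔ -1 - x ∉ B
  mul_mem_iff : ∀ k : ℤ, k * ((2 * n + 1 : ℕ) : ℤ) ∈ B' ↔ k < 0
  spread_mem_iff : ∀ x, spread n x ∈ B' ↔ x ∈ B

theorem isSpread_betaSet {n : ℕ} (hn : 0 < n) {c c' : ℕ → ℕ}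
    (hc : IsPartition c) (hcore : IsCore (2 * n) c) (hsc : SelfConj c)
    (hc' : IsPartition c') (hcore' : IsCore (2 * n + 1) c')
    (hch : ∀ i < 2 * n + 1, ncharge (2 * n + 1) c' i = extVecA n (ncharge (2 * n) c) i) :
    IsSpread n (betaSet c) (betaSet c') where
  symm_iff := hc.mem_betaSet_iff_of_selfConj hsc
  mul_mem_iff k := by
    have h := hc'.mem_betaSet_iff_lt_ncharge (by omega) hcore' k 0
    rw [hch 0 (by omega)] at h
    simpa [extVecA] using h
  spread_mem_iff x := by
    obtain ⟨k, i, hi, rfl⟩ := exists_block hn x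
    rw [spread_block hn k hi, hc'.mem_betaSet_iff_lt_ncharge (by omega) hcore',
      hc.mem_betaSet_iff_lt_ncharge (by omega) hcore, hch _ (by omega)]
    suffices extVecA n (ncharge (2 * n) c) (i + 1) = ncharge (2 * n) c i by rw [this]
    unfold extVecA
    rw [if_neg (by omega)]
    split_ifs with h1 h2
    · simp
    · rw [show 2 * n - (i + 1) = 2 * n - 1 - i by omega,
        hc.ncharge_of_selfConj hn hcore hsc hi, neg_neg]
    · omega

theorem IsSpread.zero_notMem {n : ℕ} {B : Set ℤ} {c' : ℕ → ℕ}
    (hB : IsSpread n B (betaSet c')) : (0 : ℤ) ∉ betaSet c' := by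
  simpa using (hB.mul_mem_iff 0).not

theorem IsSpread.apply_ne {n : ℕ} {B : Set ℤ} {c' : ℕ → ℕ}
    (hB : IsSpread n B (betaSet c')) (i : ℕ) : c' i ≠ i + 1 := by
  intro h
  exact hB.zero_notMem ⟨i, by simp [h]⟩

theorem IsSpread.mem_iff_neg_notMem {n : ℕ} (hn : 0 < n) {B : Set ℤ} {c' : ℕ → ℕ}
    (hB : IsSpread n B (betaSet c')) {y : ℤ} (hy : y ≠ 0) :
    y ∈ betaSet c' ↔ -y ∉ betaSet c' := by
  rcases eq_mul_or_eq_spread hn y with ⟨k, rfl⟩ | ⟨x, rfl⟩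
  · have : k ≠ 0 := by
      rintro rfl
      simp at hy
    rw [← neg_mul, hB.mul_mem_iff, hB.mul_mem_iff]
    omega
  · rw [neg_spread hn, hB.spread_mem_iff, hB.spread_mem_iff, hB.symm_iff]

theorem IsSpread.isDD {n : ℕ} (hn : 0 < n) {B : Set ℤ} {c' : ℕ → ℕ} (hc' : IsPartition c')
    (hB : IsSpread n B (betaSet c')) : IsDD c' := by
  intro i hi
  rw [hc'.lt_durfee_iff] at hi
  have hne := hB.apply_ne i
  have h := hc'.strictAnti_beta.eq_of_pos_of_range hc'.strictAnti_beta_pconj (fun y hy => ?_) i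
    (by omega)
  · omega
  · change y ∈ betaSet c' ↔ _
    rw [hB.mem_iff_neg_notMem hn hy.ne', hc'.notMem_betaSet_iff]
    exact exists_congr fun j => by constructor <;> intro h <;> simp only at * <;> omega

/-- The only candidate for a distinct partition whose double is a given partition. -/
def halve (p : ℕ → ℕ) (i : ℕ) : ℕ := p i - (i + 1)

theorem IsPartition.isPartition_halve {c' : ℕ → ℕ} (hc' : IsPartition c') :
    IsPartition (halve c') := by
  obtain ⟨ha, N, hN⟩ := hc'
  refine ⟨fun i j hij => ?_, N, fun i hi => by simp [halve, hN i hi]⟩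
  have := ha hij
  simp only [halve]
  omega

theorem IsPartition.isDistinct_halve {c' : ℕ → ℕ} (hc' : IsPartition c') :
    IsDistinct (halve c') := by
  intro i hi
  have := hc'.1 (Nat.le_succ i)
  simp only [halve, Nat.succ_eq_add_one] at *
  omega

theorem IsSpread.lt_plen_halve_iff {n : ℕ} {B : Set ℤ} {c' : ℕ → ℕ} (hc' : IsPartition c')
    (hB : IsSpread n B (betaSet c')) (i : ℕ) : i < plen (halve c') ↔ i < c' i := by
  have := hB.apply_ne i
  rw [hc'.isPartition_halve.lt_plen_iff]
  simp only [halve]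
  omega

theorem IsSpread.double_halve {n : ℕ} (hn : 0 < n) {B : Set ℤ} {c' : ℕ → ℕ} (hc' : IsPartition c')
    (hB : IsSpread n B (betaSet c')) : double (halve c') = c' := by
  funext i
  have hlt := hB.lt_plen_halve_iff hc'
  unfold double
  split_ifs with h
  · rw [hlt] at h
    simp only [halve]
    omega
  · rw [hlt] at h
    rw [← card_subtype_lt (c' i)]
    refine Nat.card_congr (Equiv.subtypeEquivRight fun j => ?_)
    rw [hlt]
    have hpc := hc'.lt_pconj_iff i j
    have hdd := hB.isDD hn hc' j
    rw [hc'.lt_durfee_iff] at hdd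
    have hsym := hc'.lt_pconj_iff j i
    simp only [halve]
    constructor
    · rintro ⟨h1, h2⟩
      have := hdd h1
      omega
    · intro h1
      have := hc'.1 (show j ≤ i by omega)
      have := hdd (by omega)
      omega

theorem eq_halve_of_double_eq {b p : ℕ → ℕ} (hb : IsPartition b) (h : double b = p) :
    b = halve p := by
  subst h
  funext i
  simp only [halve, double]
  split_ifs with hi
  · omega
  · have h0 : b i = 0 := by
      by_contra h
      exact hi ((hb.lt_plen_iff i).mpr h)
    have hle : Nat.card {j : ℕ // j < plen b ∧ i + 1 ≤ b j + j} ≤ plen b := by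
      conv_rhs => rw [← card_subtype_lt (plen b)]
      have : Finite {j : ℕ // j < plen b} := (Set.finite_lt_nat (plen b)).to_subtype
      exact Nat.card_le_card_of_injective (Subtype.impEmbedding _ _ fun _ h => h.1)
        (Subtype.impEmbedding _ _ _).injective
    omega

theorem sum_range_weight (g x : ℕ) :
    ∑ t ∈ Finset.range (x + 1), ((1 + if g ∣ t then 1 else 0) +
      if 0 < t then (1 + if g ∣ t then 1 else 0) else 0) = 2 * (x + x / g + 1) := by
  induction x with
  | zero => simp
  | succ x ih =>
    rw [Finset.sum_range_succ, ih, Nat.succ_div]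
    split_ifs <;> omega

theorem IsPartition.psize_add_resCount {c : ℕ → ℕ} (hc : IsPartition c) (hsc : SelfConj c)
    (g : ℕ) : psize c + resCount g c 0 =
      ∑ i ∈ Finset.range (durfee c), 2 * (c i - (i + 1) + (c i - (i + 1)) / g + 1) := by
  set w : ℕ × ℕ → ℕ := fun s => 1 + if (g : ℤ) ∣ (s.2 : ℤ) - s.1 then 1 else 0 with hw
  have hsum : psize c + resCount g c 0 = ∑ s ∈ cells c, w s := by
    rw [hc.psize_eq_card_cells, resCount, Finset.sum_add_distrib, Finset.card_eq_sum_ones,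
      Finset.card_filter]
    simp only [Nat.cast_zero, Int.dvd_iff_emod_eq_zero]
  have hswap : ∑ s ∈ (cells c).filter (fun s => ¬ s.1 ≤ s.2), w s =
      ∑ s ∈ (cells c).filter (fun s => s.1 < s.2), w s := by
    refine Finset.sum_nbij' Prod.swap Prod.swap ?_ ?_ (fun _ _ => rfl) (fun _ _ => rfl) ?_
    · intro s
      have := hc.lt_pconj_iff s.1 s.2
      rw [← hsc] at this
      simp only [Finset.mem_filter, hc.mem_cells_iff, Prod.fst_swap, Prod.snd_swap]
      omega
    · intro s
      have := hc.lt_pconj_iff s.1 s.2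
      rw [← hsc] at this
      simp only [Finset.mem_filter, hc.mem_cells_iff, Prod.fst_swap, Prod.snd_swap]
      omega
    · intro s _
      simp only [hw, Prod.fst_swap, Prod.snd_swap, dvd_sub_comm]
  have hlt : ∑ s ∈ (cells c).filter (fun s => s.1 < s.2), w s =
      ∑ s ∈ (cells c).filter (fun s => s.1 ≤ s.2), if s.1 < s.2 then w s else 0 := by
    rw [← Finset.sum_filter, Finset.filter_filter]
    refine Finset.sum_congr (Finset.filter_congr fun s _ => ?_) fun _ _ => rfl
    omega
  rw [hsum, ← Finset.sum_filter_add_sum_filter_not _ (fun s => s.1 ≤ s.2), hswap, hlt,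
    ← Finset.sum_add_distrib,
    Finset.sum_finset_product _ (Finset.range (durfee c)) (fun i => Finset.Ico i (c i))]
  · refine Finset.sum_congr rfl fun i hi => ?_
    rw [Finset.mem_range, hc.lt_durfee_iff] at hi
    rw [Finset.sum_Ico_eq_sum_range, ← sum_range_weight,
      show c i - i = c i - (i + 1) + 1 by omega]
    refine Finset.sum_congr rfl fun t _ => ?_
    simp [hw, Int.natCast_dvd_natCast]
  · intro s
    simp only [Finset.mem_filter, hc.mem_cells_iff, Finset.mem_range, hc.lt_durfee_iff,
      Finset.mem_Ico]
    refine ⟨fun h => ⟨by omega, h.2, h.1⟩, fun h => ⟨h.2.2, h.2.1⟩⟩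

theorem IsSpread.beta_eq_spread {n : ℕ} (hn : 0 < n) {c c' : ℕ → ℕ} (hc : IsPartition c)
    (hc' : IsPartition c') (hB : IsSpread n (betaSet c) (betaSet c')) (i : ℕ)
    (hi : i < c i ∨ i < c' i) :
    (c' i : ℤ) - (i + 1) = spread n ((c i : ℤ) - (i + 1)) := by
  have hu : StrictAnti fun m : ℕ => spread n ((c m : ℤ) - (m + 1)) :=
    (strictMono_spread hn).comp_strictAnti hc.strictAnti_beta
  have hrange : ∀ y, 0 < y → (y ∈ betaSet c' ↔
      y ∈ Set.range fun m : ℕ => spread n ((c m : ℤ) - (m + 1))) := by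
    intro y hy
    constructor
    · intro h
      rcases eq_mul_or_eq_spread hn y with ⟨k, rfl⟩ | ⟨x, rfl⟩
      · rw [hB.mul_mem_iff] at h
        exact absurd hy (not_lt.mpr (mul_nonpos_of_nonpos_of_nonneg h.le (by positivity)))
      · obtain ⟨m, rfl⟩ := (hB.spread_mem_iff x).mp h
        exact ⟨m, rfl⟩
    · rintro ⟨m, rfl⟩
      exact (hB.spread_mem_iff _).mpr ⟨m, rfl⟩
  rcases hi with hi | hi
  · exact (hu.eq_of_pos_of_range hc'.strictAnti_beta (fun y hy => (hrange y hy).symm) i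
      ((spread_pos_iff hn _).mpr (by omega))).symm
  · have := hB.apply_ne i
    exact hc'.strictAnti_beta.eq_of_pos_of_range hu hrange i (by omega)

theorem IsSpread.two_mul_psize_halve {n : ℕ} (hn : 0 < n) {c c' : ℕ → ℕ} (hc : IsPartition c)
    (hsc : SelfConj c) (hc' : IsPartition c') (hB : IsSpread n (betaSet c) (betaSet c')) :
    2 * psize (halve c') = psize c + resCount (2 * n) c 0 := by
  have hkey := hB.beta_eq_spread hn hc hc'
  have hlen : plen (halve c') = durfee c := by
    refine eq_of_forall_lt_iff fun i => ?_
    rw [hB.lt_plen_halve_iff hc', hc.lt_durfee_iff]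
    have hpos := spread_pos_iff hn ((c i : ℤ) - (i + 1))
    constructor <;> intro h
    · have := hkey i (Or.inr h)
      have := hB.apply_ne i
      omega
    · have := hkey i (Or.inl h)
      omega
  rw [hc.psize_add_resCount hsc, psize, hlen, Finset.mul_sum]
  refine Finset.sum_congr rfl fun i hi => ?_
  rw [Finset.mem_range, hc.lt_durfee_iff] at hi
  have h := hkey i (Or.inl hi)
  rw [spread, show (c i : ℤ) - (i + 1) = ((c i - (i + 1) : ℕ) : ℤ) by omega] at h
  have h' : (c' i : ℤ) - (i + 1) =
      ((c i - (i + 1) + (c i - (i + 1)) / (2 * n) + 1 : ℕ) : ℤ) := by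
    rw [h]
    push_cast
    rfl
  simp only [halve]
  omega

/-- Let `c` be a self-conjugate `2n`-core with
`φ_{2n}(c) = (m_0, …, m_{n-1}, -m_{n-1}, …, -m_0)` and let
`c' = φ_{2n+1}^{-1}(0, m_0, …, m_{n-1}, -m_{n-1}, …, -m_0)`.  Then `c'` is a
doubled distinct `(2n+1)`-core, there is a unique distinct partition
`λ̄ ∈ 𝒞_{2n+1}^{d,r}` with `c' = λ̄λ̄`, and `|λ̄| = (1/2)(|c| + a_0(c))`. -/
theorem type_A_2n_2_atomic_length (n : ℕ) (hn : 2 ≤ n) (c c' : ℕ → ℕ)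
    (hc : IsPartition c) (hcore : IsCore (2 * n) c) (hsc : SelfConj c)
    (hc' : IsPartition c') (hcore' : IsCore (2 * n + 1) c')
    (hch : ∀ i < 2 * n + 1, ncharge (2 * n + 1) c' i = extVecA n (ncharge (2 * n) c) i) :
    IsDD c' ∧
    (∃! b : ℕ → ℕ, IsPartition b ∧ IsDistinct b ∧
        ((2 * n + 1) ∉ hooksAbove (double b) ∧ ∀ i, 2 * b i ≠ 2 * n + 1) ∧
        double b = c') ∧
    (∀ b : ℕ → ℕ, IsPartition b → IsDistinct b → double b = c' →
      2 * (psize b : ℤ) = (psize c : ℤ) + (resCount (2 * n) c 0 : ℤ)) := by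
  have hpos : 0 < n := by omega
  have hB := isSpread_betaSet hpos hc hcore hsc hc' hcore' hch
  refine ⟨hB.isDD hpos hc', ⟨halve c', ⟨hc'.isPartition_halve, hc'.isDistinct_halve, ⟨?_, ?_⟩,
    hB.double_halve hpos hc'⟩, ?_⟩, ?_⟩
  · rw [hB.double_halve hpos hc']
    exact fun h => hcore' (Multiset.mem_of_le
      (Multiset.map_le_map (Finset.val_le_iff.mpr (Finset.filter_subset _ _))) h)
  · intro i
    omega
  · rintro b ⟨hb, -, -, hbc⟩
    exact eq_halve_of_double_eq hb hbc
  · intro b hb _ hbc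
    rw [eq_halve_of_double_eq hb hbc]
    exact_mod_cast hB.two_mul_psize_halve hpos hc hsc hc'
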